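/- arXiv:1003.0438 — 3 statements merged into one kernel-verified Lean document; each statement's English description precedes it below -/
import Mathlib

section
/- Let n, d, m, ρ, g be positive integers with m ≤ n, and let γ_0, γ_1, γ_2, γ_3 be natural numbers such that: m divides γ_i for every i; γ_0 + 1 ≡ γ_1 ≡ γ_2 ≡ γ_3 (mod 2); 2g + 1 ≤ γ^(1); and (as integers) γ^(2) ≤ 2(2d−1)(n−m) + 4m² − ρ². Then (2g + 1)² ≤ 8(2d−1)(n−m) + 13m² − 4ρ². -/
/-- Two distinct multiples of `m` differ by at least `m` in absolute value. -/
lemma sq_le_sub_sq_of_dvd {m a b : ℕ} (ha : m ∣ a) (hb : m ∣ b) (hab : a ≠ b) :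
    (m : ℤ) ^ 2 ≤ ((a : ℤ) - b) ^ 2 := by
  have hdvd : (m : ℤ) ∣ (a : ℤ) - b :=
    dvd_sub (Int.natCast_dvd_natCast.mpr ha) (Int.natCast_dvd_natCast.mpr hb)
  have hne : (a : ℤ) - b ≠ 0 := sub_ne_zero.mpr (by exact_mod_cast hab)
  exact Int.le_of_dvd (by positivity) (pow_dvd_pow_of_dvd hdvd 2)


/-- Arithmetic content of the first inequality of Theorem 5.5(4). -/
theorem stmt_3 (n d m ρ g : ℕ) (hn : 0 < n) (hd : 0 < d) (hm : 0 < m)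
    (hρ : 0 < ρ) (hg : 0 < g) (hmn : m ≤ n)
    (γ₀ γ₁ γ₂ γ₃ : ℕ)
    (hdvd0 : m ∣ γ₀) (hdvd1 : m ∣ γ₁) (hdvd2 : m ∣ γ₂) (hdvd3 : m ∣ γ₃)
    (h01 : (γ₀ + 1) % 2 = γ₁ % 2) (h12 : γ₁ % 2 = γ₂ % 2) (h23 : γ₂ % 2 = γ₃ % 2)
    (hgenus : 2 * g + 1 ≤ γ₀ + γ₁ + γ₂ + γ₃)
    (hsq : ((γ₀ : ℤ) ^ 2 + (γ₁ : ℤ) ^ 2 + (γ₂ : ℤ) ^ 2 + (γ₃ : ℤ) ^ 2)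
        ≤ 2 * (2 * (d : ℤ) - 1) * ((n : ℤ) - (m : ℤ)) + 4 * (m : ℤ) ^ 2 - (ρ : ℤ) ^ 2) :
    (2 * (g : ℤ) + 1) ^ 2
      ≤ 8 * (2 * (d : ℤ) - 1) * ((n : ℤ) - (m : ℤ)) + 13 * (m : ℤ) ^ 2 - 4 * (ρ : ℤ) ^ 2 := by
  have h₁ := sq_le_sub_sq_of_dvd hdvd0 hdvd1 (by omega)
  have h₂ := sq_le_sub_sq_of_dvd hdvd0 hdvd2 (by omega)
  have h₃ := sq_le_sub_sq_of_dvd hdvd0 hdvd3 (by omega)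
  have hgenus_sq : (2 * (g : ℤ) + 1) ^ 2 ≤ ((γ₀ : ℤ) + γ₁ + γ₂ + γ₃) ^ 2 := by
    exact_mod_cast Nat.pow_le_pow_left hgenus 2
  linarith [sq_nonneg ((γ₁ : ℤ) - γ₂), sq_nonneg ((γ₁ : ℤ) - γ₃), sq_nonneg ((γ₂ : ℤ) - γ₃)]
end

section
/- Let n, d, m, ρ, g be positive integers with m ≤ n, m ∣ ρ and m ∣ (2d − 1), and let γ_0, γ_1, γ_2, γ_3 be natural numbers such that: m divides γ_i for every i; γ_0 + 1 ≡ γ_1 ≡ γ_2 ≡ γ_3 (mod 2); 2g + 1 ≤ γ^(1); and (as integers) γ^(2) ≤ 2(2d−1)(n−m) + 4m² − ρ². Then (2g + 1)² ≤ (2d−1)(8n + 2d − 1). -/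
/-- Distinct multiples of `m` differ by at least `m`. -/
theorem sq_le_sq_sub_of_dvd_of_ne {m a b : ℤ} (ha : m ∣ a) (hb : m ∣ b) (hab : a ≠ b) :
    m ^ 2 ≤ (a - b) ^ 2 :=
  Int.natAbs_le_iff_sq_le.1 (Int.natAbs_le_of_dvd_ne_zero (dvd_sub ha hb) (sub_ne_zero.2 hab))

/-- Arithmetic content of the genus-degree bound `(2g+1)² ≤ (2d-1)(8n+2d-1)`. -/
theorem stmt_5 (n d m ρ g : ℕ) (hn : 0 < n) (hd : 0 < d) (hm : 0 < m)
    (hρ : 0 < ρ) (hg : 0 < g) (hmn : m ≤ n)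
    (hmρ : m ∣ ρ) (hmd : m ∣ (2 * d - 1))
    (γ₀ γ₁ γ₂ γ₃ : ℕ)
    (hdvd0 : m ∣ γ₀) (hdvd1 : m ∣ γ₁) (hdvd2 : m ∣ γ₂) (hdvd3 : m ∣ γ₃)
    (h01 : (γ₀ + 1) % 2 = γ₁ % 2) (h12 : γ₁ % 2 = γ₂ % 2) (h23 : γ₂ % 2 = γ₃ % 2)
    (hgenus : 2 * g + 1 ≤ γ₀ + γ₁ + γ₂ + γ₃)
    (hsq : ((γ₀ : ℤ) ^ 2 + (γ₁ : ℤ) ^ 2 + (γ₂ : ℤ) ^ 2 + (γ₃ : ℤ) ^ 2)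
        ≤ 2 * (2 * (d : ℤ) - 1) * ((n : ℤ) - (m : ℤ)) + 4 * (m : ℤ) ^ 2 - (ρ : ℤ) ^ 2) :
    (2 * (g : ℤ) + 1) ^ 2 ≤ (2 * (d : ℤ) - 1) * (8 * (n : ℤ) + 2 * (d : ℤ) - 1) := by
  have hm_le_ρ : (m : ℤ) ≤ ρ := by exact_mod_cast Nat.le_of_dvd hρ hmρ
  have hm_le_d : (m : ℤ) ≤ 2 * d - 1 := by
    have := Nat.le_of_dvd (by omega) hmd
    omega
  have hm_nonneg : (0 : ℤ) ≤ m := Int.natCast_nonneg m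
  have hgap {b : ℕ} (hb : m ∣ b) (hne : γ₀ ≠ b) : (m : ℤ) ^ 2 ≤ ((γ₀ : ℤ) - b) ^ 2 :=
    sq_le_sq_sub_of_dvd_of_ne (Int.natCast_dvd_natCast.2 hdvd0) (Int.natCast_dvd_natCast.2 hb)
      (by exact_mod_cast hne)
  have hgap₁ := hgap hdvd1 (by omega)
  have hgap₂ := hgap hdvd2 (by omega)
  have hgap₃ := hgap hdvd3 (by omega)
  have hρ_sq : (m : ℤ) ^ 2 ≤ (ρ : ℤ) ^ 2 := pow_le_pow_left₀ hm_nonneg hm_le_ρ 2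
  have hfactor : 0 ≤ (2 * (d : ℤ) - 1 - m) * (2 * d - 1 + 9 * m) :=
    mul_nonneg (by linarith) (by linarith)
  have hgenus_sq : (2 * (g : ℤ) + 1) ^ 2 ≤ ((γ₀ : ℤ) + γ₁ + γ₂ + γ₃) ^ 2 :=
    pow_le_pow_left₀ (by positivity) (by exact_mod_cast hgenus) 2
  linarith [sq_nonneg ((γ₁ : ℤ) - γ₂), sq_nonneg ((γ₁ : ℤ) - γ₃), sq_nonneg ((γ₂ : ℤ) - γ₃)]
end

section
/- Let n, d, g be positive integers and γ_0, γ_1, γ_2, γ_3 natural numbers such that γ_0 + 1 ≡ γ_1 ≡ γ_2 ≡ γ_3 (mod 2), 2g + 1 ≤ γ^(1), and γ^(2) ≤ (2d−1)(2n−2) + 3. Then (2g + 1)² ≤ 8(2d−1)(n−1) + 9. -/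
theorem one_le_sub_sq_of_ne {a b : ℤ} (h : a ≠ b) : 1 ≤ (a - b) ^ 2 :=
  Int.add_one_le_of_lt (sq_pos_of_ne_zero (sub_ne_zero.mpr h))

/-- Four integers, the first of which differs from the other three, satisfy a sharpened
Cauchy-Schwarz inequality. -/
theorem sq_add_add_add_le_of_ne {a b c d : ℤ} (hb : a ≠ b) (hc : a ≠ c) (hd : a ≠ d) :
    (a + b + c + d) ^ 2 + 3 ≤ 4 * (a ^ 2 + b ^ 2 + c ^ 2 + d ^ 2) := by
  linarith [one_le_sub_sq_of_ne hb, one_le_sub_sq_of_ne hc, one_le_sub_sq_of_ne hd,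
    sq_nonneg (b - c), sq_nonneg (b - d), sq_nonneg (c - d)]

/-- Arithmetic content of Theorem 5.5(5). -/
theorem stmt_6 (n d g : ℕ) (hn : 0 < n) (hd : 0 < d) (hg : 0 < g)
    (γ₀ γ₁ γ₂ γ₃ : ℕ)
    (h01 : (γ₀ + 1) % 2 = γ₁ % 2) (h12 : γ₁ % 2 = γ₂ % 2) (h23 : γ₂ % 2 = γ₃ % 2)
    (hgenus : 2 * g + 1 ≤ γ₀ + γ₁ + γ₂ + γ₃)
    (hsq : γ₀ ^ 2 + γ₁ ^ 2 + γ₂ ^ 2 + γ₃ ^ 2 ≤ (2 * d - 1) * (2 * n - 2) + 3) :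
    (2 * g + 1) ^ 2 ≤ 8 * (2 * d - 1) * (n - 1) + 9 := by
  have hcs : (γ₀ + γ₁ + γ₂ + γ₃) ^ 2 + 3 ≤ 4 * (γ₀ ^ 2 + γ₁ ^ 2 + γ₂ ^ 2 + γ₃ ^ 2) := by
    exact_mod_cast sq_add_add_add_le_of_ne (a := γ₀) (b := γ₁) (c := γ₂) (d := γ₃)
      (by omega) (by omega) (by omega)
  have hmono : (2 * g + 1) ^ 2 ≤ (γ₀ + γ₁ + γ₂ + γ₃) ^ 2 := Nat.pow_le_pow_left hgenus 2
  rw [show 2 * n - 2 = 2 * (n - 1) by omega] at hsq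
  linarith
end
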